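/- arXiv:2208.00715 — 2 statements merged into one kernel-verified Lean document; each statement's English description precedes it below -/
import Mathlib

section
/- Let ρ:ℝ→[0,∞) satisfy conditions (R1)–(R3) (bounded ρ), let V(P) be a positive definite symmetric k×k matrix, and suppose the design matrix X has full rank q with positive probability under P. Then there exists at least one vector β(P)∈ℝ^q minimizing R_P(β)=∫ρ(√((y−Xβ)ᵀV(P)⁻¹(y−Xβ)))dP(y,X). -/
open MeasureTheory ProbabilityTheory Filter Topology Matrix
open scoped BigOperators ENNReal NNReal BoundedContinuousFunction

noncomputable section

/-- Vectors in `ℝᵏ`. -/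
abbrev Vec (k : ℕ) : Type := Fin k → ℝ

/-- `k × q` real matrices, as plain functions. -/
abbrev Mat (k q : ℕ) : Type := Fin k → Fin q → ℝ

/-- An observation `s = (y, X)` consisting of a response `y ∈ ℝᵏ` and a design matrix `X`. -/
abbrev Obs (k q : ℕ) : Type := Vec k × Mat k q

/-- Squared Euclidean norm. -/
def vnorm2 {k : ℕ} (v : Vec k) : ℝ := ∑ i, v i ^ 2

/-- Euclidean norm. -/
def vnorm {k : ℕ} (v : Vec k) : ℝ := Real.sqrt (vnorm2 v)

/-- Frobenius norm of a matrix. -/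
def fnorm {k q : ℕ} (X : Mat k q) : ℝ := Real.sqrt (∑ i, ∑ j, X i j ^ 2)

/-- Norm of an observation `s = (y, X)`. -/
def onorm {k q : ℕ} (s : Obs k q) : ℝ := Real.sqrt (vnorm2 s.1 + ∑ i, ∑ j, s.2 i j ^ 2)

/-- Mahalanobis distance `d(s, β, V) = √((y − Xβ)ᵀ V⁻¹ (y − Xβ))`. -/
def mdist {k q : ℕ} (s : Obs k q) (β : Vec q) (V : Matrix (Fin k) (Fin k) ℝ) : ℝ :=
  Real.sqrt ((s.1 - (Matrix.of s.2).mulVec β) ⬝ᵥ V⁻¹.mulVec (s.1 - (Matrix.of s.2).mulVec β))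
/-- Conditions (R1)–(R3) = (R-BND): `ρ` is symmetric, continuous, `ρ 0 = 0`, nondecreasing on
`[0,∞)`, bounded by `a₀ = sup ρ > 0`, strictly increasing on `[0, c₀]` and equal to `a₀`
from `c₀` on. -/
structure RBnd (ρ : ℝ → ℝ) (a₀ c₀ : ℝ) : Prop where
  nonneg : ∀ s, 0 ≤ ρ s
  symm : ∀ s, ρ (-s) = ρ s
  cont : Continuous ρ
  zero : ρ 0 = 0
  mono : MonotoneOn ρ (Set.Ici 0)
  a0_pos : 0 < a₀
  le_a0 : ∀ s, ρ s ≤ a₀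
  c0_pos : 0 < c₀
  smono : StrictMonoOn ρ (Set.Icc 0 c₀)
  eq_a0 : ∀ s, c₀ ≤ s → ρ s = a₀

theorem seq_dichotomy (F : Type) [NormedAddCommGroup F] [NormedSpace ℝ F] (n : ℕ) :
    ∀ (E : Type) [NormedAddCommGroup E] [InnerProductSpace ℝ E] [FiniteDimensional ℝ E],
    Module.finrank ℝ E = n → ∀ β : ℕ → E, ∃ (b : E) (φ : ℕ → ℕ), StrictMono φ ∧
      ∀ X : E →ₗ[ℝ] F, Tendsto (fun i => X (β (φ i))) atTop (𝓝 (X b)) ∨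
        Tendsto (fun i => ‖X (β (φ i))‖) atTop atTop := by
  induction n with
  | zero =>
    intro E _ _ _ hE β
    have : Subsingleton E := Module.finrank_zero_iff.mp hE
    refine ⟨0, id, strictMono_id, fun X => Or.inl ?_⟩
    have : (fun i => X (β (id i))) = fun _ => X 0 := by
      funext i; rw [Subsingleton.elim (β (id i)) 0]
    rw [this]; exact tendsto_const_nhds
  | succ n ih =>
    intro E _ _ _ hE β
    by_cases hb : ∃ R : ℝ, ∃ᶠ i in atTop, β i ∈ Metric.closedBall (0:E) R
    · obtain ⟨R, hR⟩ := hb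
      obtain ⟨b, -, φ, hφ, hlim⟩ :=
        tendsto_subseq_of_frequently_bounded (Metric.isBounded_closedBall) hR
      refine ⟨b, φ, hφ, fun X => Or.inl ?_⟩
      exact ((LinearMap.continuous_of_finiteDimensional X).tendsto b).comp hlim
    · push Not at hb
      have hinf : Tendsto (fun i => ‖β i‖) atTop atTop := by
        rw [tendsto_atTop]
        intro R
        filter_upwards [hb R] with i hi
        simp at hi
        exact hi.le
      have hmem : ∀ i, (‖β i‖⁻¹ • β i) ∈ Metric.closedBall (0:E) 1 := by
        intro i
        simp [norm_smul]
        exact inv_mul_le_one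
      obtain ⟨u, -, φ, hφ, hlim⟩ :=
        tendsto_subseq_of_bounded (Metric.isBounded_closedBall) hmem
      have hinfφ := hinf.comp hφ.tendsto_atTop
      have hu1 : ‖u‖ = 1 := by
        refine tendsto_nhds_unique hlim.norm (tendsto_const_nhds.congr' ?_)
        filter_upwards [hinfφ.eventually_gt_atTop 0] with i hi
        simp only [Function.comp] at hi ⊢
        rw [norm_smul, norm_inv, norm_norm, inv_mul_cancel₀ hi.ne']
      have hu : u ≠ 0 := by
        rintro rfl; simp at hu1
      have : Fact (Module.finrank ℝ E = n + 1) := ⟨hE⟩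
      obtain ⟨b, ψ, hψ, H⟩ := ih ((ℝ ∙ u)ᗮ : Submodule ℝ E)
        (Submodule.finrank_orthogonal_span_singleton hu)
        (fun i => (ℝ ∙ u)ᗮ.orthogonalProjectionOnto (β (φ i)))
      refine ⟨b, φ ∘ ψ, hφ.comp hψ, fun X => ?_⟩
      by_cases hX : X u = 0
      · have key : ∀ v : E, X v = X ((ℝ ∙ u)ᗮ.orthogonalProjectionOnto v : E) := by
          intro v
          have h1 := (ℝ ∙ u).starProjection_add_starProjection_orthogonal v
          have h2 : X ((ℝ ∙ u).starProjection v) = 0 := by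
            obtain ⟨c, hc⟩ := Submodule.mem_span_singleton.mp
              ((ℝ ∙ u).starProjection_apply_mem v)
            rw [← hc, map_smul, hX, smul_zero]
          conv_lhs => rw [← h1, map_add, h2, zero_add]
          rfl
        have := H (X.comp (ℝ ∙ u)ᗮ.subtype)
        simp only [LinearMap.comp_apply, Submodule.subtype_apply, ← key] at this
        exact this
      · right
        have h1 : Tendsto (fun i => ‖X (‖β (φ i)‖⁻¹ • β (φ i))‖) atTop (𝓝 ‖X u‖) :=
          (((LinearMap.continuous_of_finiteDimensional X).tendsto u).comp hlim).norm
        have h2 := hinfφ.atTop_mul_pos (norm_pos_iff.mpr hX) h1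
        have h3 : Tendsto (fun i => ‖X (β (φ i))‖) atTop atTop := by
          refine h2.congr' ?_
          filter_upwards [hinfφ.eventually_gt_atTop 0] with i hi
          simp only [Function.comp] at hi ⊢
          rw [map_smul, norm_smul, norm_inv, norm_norm, mul_inv_cancel_left₀ hi.ne']
        exact h3.comp hψ.tendsto_atTop

open scoped MatrixOrder in
theorem exists_minimizer_bounded {k q : ℕ} (ρ : ℝ → ℝ) (a₀ c₀ : ℝ) (hρ : RBnd ρ a₀ c₀)
    (P : Measure (Obs k q)) [IsProbabilityMeasure P]
    (V : Matrix (Fin k) (Fin k) ℝ) (hV : V.PosDef)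
    (hrank : 0 < P {s : Obs k q | (Matrix.of s.2).rank = q}) :
    ∃ β : Vec q, ∀ β' : Vec q,
      ∫ s, ρ (mdist s β V) ∂P ≤ ∫ s, ρ (mdist s β' V) ∂P := by
  obtain ⟨B, hB⟩ : ∃ B : Matrix (Fin k) (Fin k) ℝ, V⁻¹ = Bᵀ * B := by
    obtain ⟨B, hB⟩ := CStarAlgebra.nonneg_iff_eq_star_mul_self.mp hV.inv.posSemidef.nonneg
    exact ⟨B, by simpa [Matrix.star_eq_conjTranspose] using hB⟩
  have hmd : ∀ (s : Obs k q) (β : Vec q), mdist s β V =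
      ‖WithLp.toLp 2 (B *ᵥ s.1) - WithLp.toLp 2 (B *ᵥ (Matrix.of s.2 *ᵥ β))‖ := by
    intro s β
    rw [mdist, ← WithLp.toLp_sub, ← Matrix.mulVec_sub, EuclideanSpace.norm_eq, hB,
      ← Matrix.mulVec_mulVec, Matrix.dotProduct_mulVec, Matrix.vecMul_transpose]
    simp [dotProduct, sq]
  have hmcont : ∀ β : Vec q, Continuous (fun s : Obs k q => mdist s β V) := by
    intro β
    unfold mdist
    have : Continuous (fun s : Obs k q => s.1 - (Matrix.of s.2).mulVec β) := by
      refine continuous_fst.sub ?_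
      exact Continuous.matrix_mulVec (A := fun s : Obs k q => Matrix.of s.2)
        continuous_snd continuous_const
    exact (this.dotProduct (continuous_const.matrix_mulVec this)).sqrt
  have hint : ∀ β : Vec q, Integrable (fun s => ρ (mdist s β V)) P := by
    intro β
    refine Integrable.of_bound (hρ.cont.comp (hmcont β)).aestronglyMeasurable a₀ ?_
    refine Eventually.of_forall fun s => ?_
    rw [Real.norm_eq_abs, abs_of_nonneg (hρ.nonneg _)]
    exact hρ.le_a0 _
  set R : Vec q → ℝ := fun β => ∫ s, ρ (mdist s β V) ∂P with hR
  have hbdd : BddBelow (Set.range R) :=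
    ⟨0, by rintro _ ⟨β, rfl⟩; exact integral_nonneg fun s => hρ.nonneg _⟩
  obtain ⟨r, -, hr, hrm⟩ := exists_seq_tendsto_sInf (Set.range_nonempty R) hbdd
  choose β hβ using hrm
  obtain ⟨b, φ, hφ, H⟩ := seq_dichotomy (EuclideanSpace ℝ (Fin k)) _
    (EuclideanSpace ℝ (Fin q)) rfl (fun i => WithLp.toLp 2 (β i))
  have hpt : ∀ s : Obs k q, ∃ l, Tendsto (fun i => ρ (mdist s (β (φ i)) V)) atTop (𝓝 l) ∧
      ρ (mdist s b.ofLp V) ≤ l := by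
    intro s
    let X : EuclideanSpace ℝ (Fin q) →ₗ[ℝ] EuclideanSpace ℝ (Fin k) :=
      (WithLp.linearEquiv 2 ℝ (Fin k → ℝ)).symm.toLinearMap ∘ₗ B.mulVecLin ∘ₗ
        (Matrix.of s.2).mulVecLin ∘ₗ (WithLp.linearEquiv 2 ℝ (Fin q → ℝ)).toLinearMap
    have hX : ∀ v : EuclideanSpace ℝ (Fin q),
        mdist s v.ofLp V = ‖WithLp.toLp 2 (B *ᵥ s.1) - X v‖ := fun v => hmd s v.ofLp
    have hX' : ∀ i, mdist s (β i) V =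
      ‖WithLp.toLp 2 (B *ᵥ s.1) - X (WithLp.toLp 2 (β i))‖ := fun i => hmd s _
    rcases H X with h | h
    · refine ⟨_, ?_, le_rfl⟩
      refine (hρ.cont.tendsto _).comp ?_
      simp only [hX]
      exact (tendsto_const_nhds.sub h).norm
    · refine ⟨a₀, ?_, hρ.le_a0 _⟩
      refine tendsto_const_nhds.congr' ?_
      filter_upwards [h.eventually_ge_atTop (c₀ + ‖WithLp.toLp 2 (B *ᵥ s.1)‖)] with i hi
      refine (hρ.eq_a0 _ ?_).symm
      rw [hX']
      have := norm_sub_norm_le (X (WithLp.toLp 2 (β (φ i)))) (WithLp.toLp 2 (B *ᵥ s.1))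
      rw [norm_sub_rev] at this
      linarith
  choose g hg hgle using hpt
  have hgm : AEStronglyMeasurable g P :=
    aestronglyMeasurable_of_tendsto_ae atTop (fun i => (hint (β (φ i))).aestronglyMeasurable)
      (Eventually.of_forall hg)
  have hg0 : ∀ s, ‖g s‖ ≤ a₀ := by
    intro s
    have h0 : 0 ≤ g s := (hρ.nonneg _).trans (hgle s)
    rw [Real.norm_eq_abs, abs_of_nonneg h0]
    exact le_of_tendsto' (hg s) fun i => hρ.le_a0 _
  have hgi : Integrable g P := Integrable.of_bound hgm a₀ (Eventually.of_forall hg0)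
  have hlim : Tendsto (fun i => R (β (φ i))) atTop (𝓝 (∫ s, g s ∂P)) := by
    refine tendsto_integral_of_dominated_convergence (fun _ => a₀)
      (fun i => (hint (β (φ i))).aestronglyMeasurable) (integrable_const _) ?_
      (Eventually.of_forall hg)
    refine fun i => Eventually.of_forall fun s => ?_
    rw [Real.norm_eq_abs, abs_of_nonneg (hρ.nonneg _)]
    exact hρ.le_a0 _
  have heq : ∫ s, g s ∂P = sInf (Set.range R) := by
    refine tendsto_nhds_unique hlim ?_
    simp only [hβ]
    exact hr.comp hφ.tendsto_atTop
  refine ⟨b.ofLp, fun β' => ?_⟩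
  calc R b.ofLp ≤ ∫ s, g s ∂P := integral_mono (hint _) hgi hgle
    _ = sInf (Set.range R) := heq
    _ ≤ R β' := csInf_le hbdd ⟨β', rfl⟩
end
end

section
/- Let ρ:ℝ→[0,∞) satisfy condition (R), let P satisfy E_P‖X‖<∞ with X of full rank with probability one, and let V(P) be positive definite. Then there exists at least one vector β_P minimizing R_P(β)=∫[ρ(√((y−Xβ)ᵀV(P)⁻¹(y−Xβ)))−ρ(√(yᵀV(P)⁻¹y))]dP(y,X); and if ρ is in addition strictly convex, then the minimizer β_P is unique. -/
open MeasureTheory ProbabilityTheory Filter Topology Matrix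
open scoped BigOperators ENNReal NNReal BoundedContinuousFunction

noncomputable section

/-- Condition (R) = (R-UNB): `ρ` is symmetric, nonnegative, `ρ 0 = 0`, `ρ(s) → ∞`, `ρ'` and
`u(s) = ρ'(s)/s` are continuous, `ρ' ≥ 0` on `[0,∞)`, and `ρ'` is nondecreasing on `(0, s₀)`
and nonincreasing on `(s₀, ∞)`. -/
structure RUnb (ρ : ℝ → ℝ) (s₀ : ℝ) : Prop where
  nonneg : ∀ s, 0 ≤ ρ s
  symm : ∀ s, ρ (-s) = ρ s
  zero : ρ 0 = 0
  tendsto_top : Tendsto ρ atTop atTop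
  diff : Differentiable ℝ ρ
  deriv_cont : Continuous (deriv ρ)
  u_cont : ∃ u : ℝ → ℝ, Continuous u ∧ ∀ s ≠ 0, u s = deriv ρ s / s
  deriv_nonneg : ∀ s, 0 ≤ s → 0 ≤ deriv ρ s
  s0_pos : 0 < s₀
  deriv_mono : MonotoneOn (deriv ρ) (Set.Ioo 0 s₀)
  deriv_anti : AntitoneOn (deriv ρ) (Set.Ioi s₀)
namespace RUnb
variable {ρ : ℝ → ℝ} {s₀ : ℝ}

theorem bdd (h : RUnb ρ s₀) : ∃ L : ℝ, 0 ≤ L ∧ ∀ s, 0 ≤ s → deriv ρ s ≤ L := by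
  obtain ⟨L, hL⟩ := (isCompact_Icc (a := (0:ℝ)) (b := s₀ + 1)).exists_bound_of_continuousOn
    h.deriv_cont.continuousOn
  have hp := h.s0_pos
  have hL1 := hL (s₀ + 1) ⟨by linarith, le_refl _⟩
  refine ⟨L, (norm_nonneg _).trans hL1, fun s hs => ?_⟩
  rcases le_total s (s₀ + 1) with h1 | h1
  · exact (le_abs_self _).trans (hL s ⟨hs, h1⟩)
  · have := h.deriv_anti (show s₀ + 1 ∈ Set.Ioi s₀ from by simp)
      (show s ∈ Set.Ioi s₀ from by simp; linarith) h1
    exact this.trans ((le_abs_self _).trans hL1)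

theorem mono (h : RUnb ρ s₀) : MonotoneOn ρ (Set.Ici 0) := by
  apply monotoneOn_of_deriv_nonneg (convex_Ici 0) h.diff.continuous.continuousOn
    h.diff.differentiableOn
  intro x hx
  rw [interior_Ici] at hx
  exact h.deriv_nonneg x (le_of_lt hx)

theorem upper (h : RUnb ρ s₀) {L : ℝ} (hL : ∀ s, 0 ≤ s → deriv ρ s ≤ L) {a b : ℝ}
    (ha : 0 ≤ a) (hab : a ≤ b) : ρ b - ρ a ≤ L * (b - a) := by
  apply Convex.image_sub_le_mul_sub_of_deriv_le (convex_Ici 0) h.diff.continuous.continuousOn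
    h.diff.differentiableOn _ a ha b (ha.trans hab) hab
  intro x hx
  rw [interior_Ici] at hx
  exact hL x (le_of_lt hx)

theorem lip (h : RUnb ρ s₀) {L : ℝ} (hL : ∀ s, 0 ≤ s → deriv ρ s ≤ L) {a b : ℝ}
    (ha : 0 ≤ a) (hb : 0 ≤ b) : |ρ a - ρ b| ≤ L * |a - b| := by
  rcases le_total a b with hab | hab
  · rw [abs_sub_comm, abs_sub_comm a b, abs_of_nonneg (sub_nonneg.2 (h.mono ha hb hab)),
      abs_of_nonneg (sub_nonneg.2 hab)]
    exact h.upper hL ha hab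
  · rw [abs_of_nonneg (sub_nonneg.2 (h.mono hb ha hab)),
      abs_of_nonneg (sub_nonneg.2 hab)]
    exact h.upper hL hb hab

theorem subadd (h : RUnb ρ s₀) {L : ℝ} (hL : ∀ s, 0 ≤ s → deriv ρ s ≤ L) {a b : ℝ}
    (ha : 0 ≤ a) (hb : 0 ≤ b) : ρ (a + b) ≤ ρ a + ρ b + L * s₀ := by
  have hp := h.s0_pos
  have h2 := h.upper hL hb (show b ≤ s₀ + b by linarith)
  have e : s₀ + b - b = s₀ := by ring
  rw [e] at h2
  rcases le_total a s₀ with h1 | h1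
  · have := h.mono (show a + b ∈ Set.Ici (0:ℝ) from add_nonneg ha hb)
      (show s₀ + b ∈ Set.Ici (0:ℝ) from add_nonneg hp.le hb) (by linarith)
    linarith [h.nonneg a]
  · have hd : ∀ x, HasDerivAt (fun a => ρ (a + b) - ρ a) (deriv ρ (x + b) - deriv ρ x) x := by
      intro x
      exact ((h.diff (x + b)).hasDerivAt.comp_add_const x b).sub (h.diff x).hasDerivAt
    have hanti : AntitoneOn (fun a => ρ (a + b) - ρ a) (Set.Ici s₀) := by
      apply antitoneOn_of_deriv_nonpos (convex_Ici s₀)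
      · exact fun x _ => (hd x).continuousAt.continuousWithinAt
      · exact fun x _ => (hd x).differentiableAt.differentiableWithinAt
      · intro x hx
        rw [interior_Ici] at hx
        rw [(hd x).deriv]
        have := h.deriv_anti hx (show x + b ∈ Set.Ioi s₀ from by
          have : s₀ < x := hx
          simp; linarith) (by linarith)
        linarith
    have := hanti (Set.mem_Ici.2 (le_refl s₀)) (show a ∈ Set.Ici s₀ from h1) h1
    simp only at this
    linarith [h.nonneg s₀]

/-- existence of a shifted subadditive version -/
theorem shift (h : RUnb ρ s₀) : ∃ L C : ℝ, 0 ≤ L ∧ 0 ≤ C ∧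
    (∀ a b, 0 ≤ a → 0 ≤ b → |ρ a - ρ b| ≤ L * |a - b|) ∧
    (∀ a b, 0 ≤ a → 0 ≤ b → ρ (a + b) + C ≤ (ρ a + C) + (ρ b + C)) ∧
    (∀ t a, 0 ≤ t → 0 ≤ a → ρ (t * a) + C ≤ (t + 1) * (ρ a + C)) := by
  obtain ⟨L, hL0, hL⟩ := h.bdd
  have hp := h.s0_pos
  have hC : 0 ≤ L * s₀ := by positivity
  have hsub : ∀ a b, 0 ≤ a → 0 ≤ b → ρ (a + b) + L * s₀ ≤ (ρ a + L * s₀) + (ρ b + L * s₀) :=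
    fun a b ha hb => by linarith [h.subadd hL ha hb]
  refine ⟨L, L * s₀, hL0, hC, fun a b ha hb => h.lip hL ha hb, hsub, fun t a ht ha => ?_⟩
  have hn : ∀ n : ℕ, ρ (n * a) + L * s₀ ≤ (n + 1) * (ρ a + L * s₀) ∧
      ρ ((n + 1) * a) + L * s₀ ≤ (n + 1) * (ρ a + L * s₀) := by
    intro n
    induction n with
    | zero => simp [h.zero, h.nonneg a]
    | succ n ih =>
      have h1 := hsub ((n + 1) * a) a (by positivity) ha
      have e : ((n:ℝ) + 1) * a + a = (n + 1 + 1) * a := by ring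
      rw [e] at h1
      push_cast
      have := h.nonneg a
      constructor <;> nlinarith [ih.2]
  have h1 := (hn ⌊t⌋₊).2
  have h2 : ρ (t * a) ≤ ρ ((⌊t⌋₊ + 1) * a) :=
    h.mono (show t * a ∈ Set.Ici (0:ℝ) from mul_nonneg ht ha)
      (show (⌊t⌋₊ + 1) * a ∈ Set.Ici (0:ℝ) from by simp only [Set.mem_Ici]; positivity)
      (mul_le_mul_of_nonneg_right (Nat.lt_floor_add_one t).le ha)
  have h3 := Nat.floor_le ht
  have := h.nonneg a
  nlinarith
end RUnb

theorem exists_factor {k : ℕ} (V : Matrix (Fin k) (Fin k) ℝ) (hV : V.PosDef) :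
    ∃ T : Vec k →ₗ[ℝ] EuclideanSpace ℝ (Fin k), Function.Injective T ∧
      ∀ v, Real.sqrt (v ⬝ᵥ V⁻¹.mulVec v) = ‖T v‖ := by
  have hA := hV.inv
  obtain ⟨B, hB⟩ : ∃ B : Matrix (Fin k) (Fin k) ℝ, V⁻¹ = Bᵀ * B := by
    open scoped MatrixOrder Matrix.Norms.L2Operator in
    obtain ⟨B, hB⟩ := CStarAlgebra.nonneg_iff_eq_star_mul_self.mp hA.posSemidef.nonneg
    exact ⟨B, by rw [hB, Matrix.star_eq_conjTranspose, Matrix.conjTranspose_eq_transpose_of_trivial]⟩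
  have key : ∀ v, v ⬝ᵥ V⁻¹.mulVec v = ‖(WithLp.toLp 2 (B.mulVec v) : EuclideanSpace ℝ (Fin k))‖ ^ 2 := by
    intro v
    rw [hB, ← Matrix.mulVec_mulVec, Matrix.dotProduct_mulVec, Matrix.vecMul_transpose,
      EuclideanSpace.norm_sq_eq]
    simp [dotProduct, sq]
  refine ⟨(WithLp.linearEquiv 2 ℝ (Fin k → ℝ)).symm.toLinearMap ∘ₗ B.mulVecLin, ?_, ?_⟩
  · rw [← LinearMap.ker_eq_bot, LinearMap.ker_eq_bot']
    intro v hv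
    by_contra hne
    have h1 := hA.dotProduct_mulVec_pos hne
    have h2 : (WithLp.toLp 2 (B.mulVec v) : EuclideanSpace ℝ (Fin k)) = 0 := hv
    simp only [star_trivial] at h1
    rw [key, h2] at h1
    simp at h1
  · intro v
    rw [key, Real.sqrt_sq (norm_nonneg _)]
    rfl

theorem mulVec_norm_le {k q : ℕ} (X : Mat k q) (β : Vec q) :
    ‖(Matrix.of X).mulVec β‖ ≤ q * ‖X‖ * ‖β‖ := by
  refine (pi_norm_le_iff_of_nonneg (by positivity)).2 fun i => ?_
  rw [Matrix.mulVec, dotProduct]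
  refine (norm_sum_le _ _).trans ?_
  have : ∀ j ∈ Finset.univ, ‖(Matrix.of X) i j * β j‖ ≤ ‖X‖ * ‖β‖ := by
    intro j _
    rw [norm_mul]
    exact mul_le_mul ((norm_le_pi_norm (X i) j).trans (norm_le_pi_norm X i)) (norm_le_pi_norm β j)
      (norm_nonneg _) (norm_nonneg _)
  refine (Finset.sum_le_card_nsmul _ _ _ this).trans ?_
  simp [mul_assoc]

theorem norm_le_fnorm {k q : ℕ} (X : Mat k q) : ‖X‖ ≤ fnorm X := by
  have h0 : 0 ≤ fnorm X := Real.sqrt_nonneg _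
  refine (pi_norm_le_iff_of_nonneg h0).2 fun i => (pi_norm_le_iff_of_nonneg h0).2 fun j => ?_
  rw [fnorm, Real.norm_eq_abs]
  apply Real.abs_le_sqrt
  exact (Finset.single_le_sum (f := fun j => X i j ^ 2) (fun _ _ => sq_nonneg _) (Finset.mem_univ j)).trans
    (Finset.single_le_sum (f := fun i => ∑ j, X i j ^ 2)
      (fun _ _ => Finset.sum_nonneg fun _ _ => sq_nonneg _) (Finset.mem_univ i))

theorem rank_iff {k q : ℕ} (X : Mat k q) (T : Vec k →ₗ[ℝ] EuclideanSpace ℝ (Fin k))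
    (hT : Function.Injective T) :
    (Matrix.of X).rank = q ↔ ∃ n : ℕ, ∀ β : Vec q, ‖β‖ ≤ n * ‖T ((Matrix.of X).mulVec β)‖ := by
  have hr : (Matrix.of X).rank = q ↔ (Matrix.of X).mulVecLin.ker = ⊥ := by
    have := LinearMap.finrank_range_add_finrank_ker (Matrix.of X).mulVecLin
    rw [Matrix.rank, ← Submodule.finrank_eq_zero (R := ℝ)]
    simp only [Module.finrank_fin_fun] at this
    omega
  rw [hr]
  constructor
  · intro h
    obtain ⟨K, hK, hA⟩ := (T ∘ₗ (Matrix.of X).mulVecLin).exists_antilipschitzWith (by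
      rw [LinearMap.ker_eq_bot] at h ⊢
      exact hT.comp h)
    obtain ⟨n, hn⟩ := exists_nat_ge (K : ℝ)
    refine ⟨n, fun β => ?_⟩
    have := hA.le_mul_dist β 0
    simp only [dist_zero_right, map_zero] at this
    exact this.trans (mul_le_mul_of_nonneg_right hn (norm_nonneg _))
  · rintro ⟨n, hn⟩
    rw [LinearMap.ker_eq_bot']
    intro β hβ
    have := hn β
    rw [Matrix.mulVecLin_apply] at hβ
    rw [hβ] at this
    simpa using this

theorem core {k q : ℕ} (ρ : ℝ → ℝ) (s₀ : ℝ) (hρ : RUnb ρ s₀)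
    (P : Measure (Obs k q)) [IsProbabilityMeasure P]
    (hmom : Integrable (fun s : Obs k q => fnorm s.2) P)
    (hrank : P {s : Obs k q | (Matrix.of s.2).rank = q} = 1)
    (T : Vec k →ₗ[ℝ] EuclideanSpace ℝ (Fin k)) (hT : Function.Injective T)
    (f : Vec q → Obs k q → ℝ)
    (hf : ∀ β s, f β s = ρ ‖T (s.1 - (Matrix.of s.2).mulVec β)‖ - ρ ‖T s.1‖) :
    (∃ βP : Vec q, ∀ β : Vec q, ∫ s, f βP s ∂P ≤ ∫ s, f β s ∂P) ∧
    (StrictConvexOn ℝ Set.univ ρ →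
      ∃! βP : Vec q, ∀ β : Vec q, ∫ s, f βP s ∂P ≤ ∫ s, f β s ∂P) := by
  obtain ⟨L, C, hL0, hC0, hlip, hsub, hmul⟩ := hρ.shift
  have hTc : Continuous T := T.continuous_of_finiteDimensional
  have hρc : Continuous ρ := hρ.diff.continuous
  have hXc : ∀ β : Vec q, Continuous fun s : Obs k q => (Matrix.of s.2).mulVec β := by
    intro β
    refine continuous_pi fun i => ?_
    simp only [Matrix.mulVec, dotProduct, Matrix.of_apply]
    fun_prop
  -- bound on `T (X β)`
  obtain ⟨K, hK0, hK⟩ : ∃ K : ℝ, 0 ≤ K ∧ ∀ (X : Mat k q) (β : Vec q),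
      ‖T ((Matrix.of X).mulVec β)‖ ≤ K * ‖X‖ * ‖β‖ := by
    refine ⟨‖LinearMap.toContinuousLinearMap T‖ * q, by positivity, fun X β => ?_⟩
    have h1 := (LinearMap.toContinuousLinearMap T).le_opNorm ((Matrix.of X).mulVec β)
    refine h1.trans ?_
    have h2 := mul_le_mul_of_nonneg_left (mulVec_norm_le X β)
      (norm_nonneg (LinearMap.toContinuousLinearMap T))
    refine h2.trans (le_of_eq (by ring))
  have hfc : ∀ β, Continuous (f β) := by
    intro β
    have : f β = fun s => ρ ‖T (s.1 - (Matrix.of s.2).mulVec β)‖ - ρ ‖T s.1‖ := funext (hf β)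
    rw [this]
    have := hXc β
    fun_prop
  have hint : Integrable (fun s : Obs k q => ‖s.2‖) P := by
    refine hmom.mono' (by fun_prop) (ae_of_all _ fun s => ?_)
    rw [norm_norm]
    exact norm_le_fnorm _
  have hf0 : ∀ s, f 0 s = 0 := by intro s; simp [hf]
  have hfl : ∀ β β' s, |f β s - f β' s| ≤ (L * K * ‖s.2‖) * ‖β - β'‖ := by
    intro β β' s
    rw [hf, hf, sub_sub_sub_cancel_right]
    refine (hlip _ _ (norm_nonneg _) (norm_nonneg _)).trans ?_
    have h1 := abs_norm_sub_norm_le (T (s.1 - (Matrix.of s.2).mulVec β))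
      (T (s.1 - (Matrix.of s.2).mulVec β'))
    have e : T (s.1 - (Matrix.of s.2).mulVec β) - T (s.1 - (Matrix.of s.2).mulVec β')
        = - T ((Matrix.of s.2).mulVec (β - β')) := by
      rw [← map_sub, ← map_neg, Matrix.mulVec_sub]
      congr 1; abel
    rw [e, norm_neg] at h1
    have := mul_le_mul_of_nonneg_left (h1.trans (hK s.2 (β - β'))) hL0
    linarith
  have hfi : ∀ β, Integrable (f β) P := by
    intro β
    refine ((hint.const_mul (L * K)).mul_const ‖β‖).mono' (hfc β).aestronglyMeasurable
      (ae_of_all _ fun s => ?_)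
    have := hfl β 0 s
    rwa [hf0, sub_zero, sub_zero] at this
  have hFc : Continuous fun β => ∫ s, f β s ∂P := by
    apply LipschitzWith.continuous (K := (L * K * ∫ s, ‖s.2‖ ∂P).toNNReal)
    apply LipschitzWith.of_dist_le_mul
    intro β β'
    rw [Real.coe_toNNReal _ (by positivity), dist_eq_norm, dist_eq_norm,
      ← integral_sub (hfi β) (hfi β')]
    refine (norm_integral_le_of_norm_le ((hint.const_mul (L * K)).mul_const ‖β - β'‖)
      (ae_of_all _ fun s => hfl β β' s)).trans (le_of_eq ?_)
    rw [integral_mul_const, integral_const_mul]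
  -- the sets `G n`
  let G : ℕ → Set (Obs k q) := fun n => {s | ∀ β : Vec q, ‖β‖ ≤ n * ‖T ((Matrix.of s.2).mulVec β)‖}
  have hGm : ∀ n, MeasurableSet (G n) := by
    intro n
    apply IsClosed.measurableSet
    have : G n = ⋂ β : Vec q, {s | ‖β‖ ≤ n * ‖T ((Matrix.of s.2).mulVec β)‖} := by
      ext s; simp [G]
    rw [this]
    refine isClosed_iInter fun β => isClosed_le continuous_const ?_
    have := hXc β
    fun_prop
  have hGu : {s : Obs k q | (Matrix.of s.2).rank = q} = ⋃ n, G n := by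
    ext s
    rw [Set.mem_iUnion]
    exact rank_iff s.2 T hT
  have hae : ∀ᵐ s ∂P, ∃ n, s ∈ G n := by
    rw [hGu] at hrank
    have := (mem_ae_iff_prob_eq_one (MeasurableSet.iUnion hGm)).2 hrank
    filter_upwards [this] with s hs
    simpa using hs
  have hcoer : Tendsto (fun β => ∫ s, f β s ∂P) (cocompact (Vec q)) atTop := by
    obtain ⟨N, hN⟩ : ∃ N, P (G N) ≠ 0 := by
      by_contra! hcon
      have h0 := measure_iUnion_null hcon
      rw [← hGu, hrank] at h0
      exact one_ne_zero h0
    let A : ℕ → Set (Obs k q) := fun n => {s | ‖T s.1‖ ≤ n}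
    have hAm : ∀ n, MeasurableSet (A n) := fun n =>
      (isClosed_le (by fun_prop) continuous_const).measurableSet
    let w : ℕ → Obs k q → ℝ := fun n s =>
      (A n ∩ G N).indicator (fun _ => ((N:ℝ) + 1)⁻¹) s - (A n)ᶜ.indicator (fun s => K * ‖s.2‖ + 1) s
    have hwm : ∀ n, Measurable (w n) := by
      intro n
      refine (measurable_const.indicator ((hAm n).inter (hGm N))).sub
        (Measurable.indicator (by fun_prop) (hAm n).compl)
    have hinv : ((N:ℝ) + 1)⁻¹ ≤ 1 := inv_le_one_of_one_le₀ (by linarith [Nat.cast_nonneg (α := ℝ) N])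
    have hinv0 : 0 < ((N:ℝ) + 1)⁻¹ := by positivity
    have hwb : ∀ n s, ‖w n s‖ ≤ K * ‖s.2‖ + 1 := by
      intro n s
      have hn : 0 ≤ K * ‖s.2‖ := by positivity
      simp only [w, Set.indicator, Real.norm_eq_abs]
      by_cases h1 : s ∈ A n <;> by_cases h2 : s ∈ G N <;> simp only [Set.mem_inter_iff, Set.mem_compl_iff, h1, h2, and_true, and_false, not_true,
          not_false_iff, if_true, if_false, abs_le] <;> constructor <;> linarith
    have hbi : Integrable (fun s : Obs k q => K * ‖s.2‖ + 1) P :=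
      (hint.const_mul K).add (integrable_const 1)
    have hwi : ∀ n, Integrable (w n) P := fun n =>
      hbi.mono' (hwm n).aestronglyMeasurable (ae_of_all _ (hwb n))
    have hlim : Tendsto (fun n => ∫ s, w n s ∂P) atTop
        (𝓝 (∫ s, (G N).indicator (fun _ => ((N:ℝ) + 1)⁻¹) s ∂P)) := by
      refine tendsto_integral_of_dominated_convergence _ (fun n => (hwm n).aestronglyMeasurable)
        hbi (fun n => ae_of_all _ (hwb n)) (ae_of_all _ fun s => ?_)
      apply tendsto_const_nhds.congr'
      obtain ⟨m, hm⟩ := exists_nat_ge ‖T s.1‖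
      filter_upwards [eventually_ge_atTop m] with n hn
      have hA : s ∈ A n := hm.trans (by exact_mod_cast hn)
      by_cases hG : s ∈ G N <;> simp [w, hA, hG]
    have hpos : 0 < ∫ s, (G N).indicator (fun _ => ((N:ℝ) + 1)⁻¹) s ∂P := by
      rw [integral_indicator_const _ (hGm N), smul_eq_mul]
      refine mul_pos ?_ hinv0
      exact ENNReal.toReal_pos hN (measure_ne_top _ _)
    obtain ⟨M, hM⟩ := ((hlim.eventually (lt_mem_nhds hpos))).exists
    set D : ℝ := 2 * (ρ M + C) with hD
    have hpt : ∀ β s, (ρ ‖β‖ + C) * w M s - D ≤ f β s := by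
      intro β s
      have hφ : 0 ≤ ρ ‖β‖ + C := add_nonneg (hρ.nonneg _) hC0
      have hφM : 0 ≤ ρ M + C := add_nonneg (hρ.nonneg _) hC0
      set b := T ((Matrix.of s.2).mulVec β) with hb
      have e : f β s = ρ ‖T s.1 - b‖ - ρ ‖T s.1‖ := by rw [hf, map_sub]
      have h1 : -(ρ ‖b‖ + C) ≤ f β s := by
        have := hsub ‖T s.1 - b‖ ‖b‖ (norm_nonneg _) (norm_nonneg _)
        have h2 : ρ ‖T s.1‖ ≤ ρ (‖T s.1 - b‖ + ‖b‖) :=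
          hρ.mono (norm_nonneg _) (Set.mem_Ici.2 (by positivity)) (by
            simpa using norm_add_le (T s.1 - b) b)
        linarith
      have h2 : (ρ ‖b‖ + C) - 2 * (ρ ‖T s.1‖ + C) ≤ f β s := by
        have := hsub ‖T s.1 - b‖ ‖T s.1‖ (norm_nonneg _) (norm_nonneg _)
        have h2 : ρ ‖b‖ ≤ ρ (‖T s.1 - b‖ + ‖T s.1‖) :=
          hρ.mono (norm_nonneg _) (Set.mem_Ici.2 (by positivity)) (by
            have := norm_sub_le (T s.1) (T s.1 - b)
            rw [sub_sub_cancel] at this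
            linarith)
        linarith
      by_cases hA : s ∈ A M
      · have hA' : ρ ‖T s.1‖ ≤ ρ M := hρ.mono (norm_nonneg _) (Set.mem_Ici.2 (by positivity)) hA
        by_cases hG : s ∈ G N
        · have hw : w M s = ((N:ℝ) + 1)⁻¹ := by simp [w, hA, hG]
          rw [hw]
          have h3 := hmul N ‖b‖ (Nat.cast_nonneg _) (norm_nonneg _)
          have h4 : ρ ‖β‖ ≤ ρ (N * ‖b‖) :=
            hρ.mono (norm_nonneg _) (Set.mem_Ici.2 (by positivity)) (hG β)
          have h5 : (ρ ‖β‖ + C) * ((N:ℝ) + 1)⁻¹ ≤ ρ ‖b‖ + C := by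
            rw [← div_eq_mul_inv, div_le_iff₀ (by positivity)]
            linarith
          linarith
        · have hw : w M s = 0 := by simp [w, hA, hG]
          rw [hw]
          linarith [hρ.nonneg ‖b‖]
      · have hw : w M s = -(K * ‖s.2‖ + 1) := by simp [w, hA]
        rw [hw]
        have h3 := hmul (K * ‖s.2‖) ‖β‖ (by positivity) (norm_nonneg _)
        have h4 : ρ ‖b‖ ≤ ρ (K * ‖s.2‖ * ‖β‖) :=
          hρ.mono (norm_nonneg _) (Set.mem_Ici.2 (by positivity)) (hK s.2 β)
        linarith
    have hlow : ∀ β, (ρ ‖β‖ + C) * (∫ s, w M s ∂P) - D ≤ ∫ s, f β s ∂P := by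
      intro β
      have h1 : Integrable (fun s => (ρ ‖β‖ + C) * w M s - D) P :=
        ((hwi M).const_mul _).sub (integrable_const _)
      have h2 := integral_mono h1 (hfi β) (hpt β)
      rw [integral_sub ((hwi M).const_mul _) (integrable_const _), integral_const_mul] at h2
      simpa using h2
    refine tendsto_atTop_mono hlow ?_
    apply tendsto_atTop_add_const_right
    apply Tendsto.atTop_mul_const hM
    apply tendsto_atTop_add_const_right
    exact hρ.tendsto_top.comp (tendsto_norm_cocompact_atTop (E := Vec q))
  have hex := hFc.exists_forall_le hcoer
  refine ⟨hex, fun hsc => ?_⟩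
  obtain ⟨β₁, h₁⟩ := hex
  refine ⟨β₁, h₁, fun β₂ h₂ => ?_⟩
  by_contra hne
  have hstr : ∀ a b : ℝ, 0 ≤ a → a < b → ρ a < ρ b := by
    intro a b ha hab
    refine lt_of_le_of_ne (hρ.mono ha (Set.mem_Ici.2 (ha.trans hab.le)) hab.le) fun heq => ?_
    have h3 := hsc.2 (Set.mem_univ a) (Set.mem_univ b) hab.ne
      (half_pos one_pos) (half_pos one_pos) (add_halves 1)
    have h4 : ρ a ≤ ρ ((1/2 : ℝ) • a + (1/2 : ℝ) • b) := hρ.mono ha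
      (Set.mem_Ici.2 (by simp only [smul_eq_mul]; linarith)) (by simp only [smul_eq_mul]; linarith)
    simp only [smul_eq_mul] at h3 h4
    linarith
  set m : Vec q := (1/2 : ℝ) • β₁ + (1/2 : ℝ) • β₂ with hm
  have hlt : ∀ᵐ s ∂P, f m s < 1/2 * f β₁ s + 1/2 * f β₂ s := by
    filter_upwards [hae] with s hs
    obtain ⟨n, hn⟩ := hs
    set v₁ := T (s.1 - (Matrix.of s.2).mulVec β₁) with hv₁
    set v₂ := T (s.1 - (Matrix.of s.2).mulVec β₂) with hv₂
    have hv : T (s.1 - (Matrix.of s.2).mulVec m) = (1/2 : ℝ) • v₁ + (1/2 : ℝ) • v₂ := by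
      rw [hv₁, hv₂, ← map_smul, ← map_smul, ← map_add, hm, Matrix.mulVec_add, Matrix.mulVec_smul,
        Matrix.mulVec_smul]
      congr 1
      module
    have hvne : v₁ ≠ v₂ := by
      intro h
      have h3 := hT h
      have h4 : (Matrix.of s.2).mulVec (β₁ - β₂) = 0 := by
        rw [Matrix.mulVec_sub, sub_eq_zero]
        exact sub_right_injective h3
      have h5 := hn (β₁ - β₂)
      rw [h4] at h5
      simp only [map_zero, norm_zero, mul_zero, norm_le_zero_iff, sub_eq_zero] at h5
      exact hne h5.symm
    have hmain : ρ ‖(1/2 : ℝ) • v₁ + (1/2 : ℝ) • v₂‖ < 1/2 * ρ ‖v₁‖ + 1/2 * ρ ‖v₂‖ := by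
      by_cases heq : ‖v₁‖ = ‖v₂‖
      · have := norm_combo_lt_of_ne (le_refl ‖v₁‖) heq.ge hvne (a := 1/2) (b := 1/2)
          (by norm_num) (by norm_num) (by norm_num)
        have := hstr _ _ (norm_nonneg _) this
        rw [← heq]
        linarith
      · have h3 := hsc.2 (Set.mem_univ ‖v₁‖) (Set.mem_univ ‖v₂‖) heq
          (half_pos one_pos) (half_pos one_pos) (add_halves 1)
        simp only [smul_eq_mul] at h3
        refine lt_of_le_of_lt (hρ.mono (norm_nonneg _) (Set.mem_Ici.2 (by positivity)) ?_) h3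
        refine (norm_add_le _ _).trans (le_of_eq ?_)
        simp [norm_smul]
    rw [hf, hf, hf, hv]
    linarith
  have hgi : Integrable (fun s => 1/2 * f β₁ s + 1/2 * f β₂ s) P :=
    ((hfi β₁).const_mul _).add ((hfi β₂).const_mul _)
  have hIm : ∫ s, (1/2 * f β₁ s + 1/2 * f β₂ s) ∂P
      = 1/2 * ∫ s, f β₁ s ∂P + 1/2 * ∫ s, f β₂ s ∂P := by
    rw [integral_add ((hfi β₁).const_mul _) ((hfi β₂).const_mul _), integral_const_mul,
      integral_const_mul]
  have hz : ∫ s, ((1/2 * f β₁ s + 1/2 * f β₂ s) - f m s) ∂P = 0 := by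
    apply le_antisymm
    · rw [integral_sub hgi (hfi m), hIm]
      linarith [h₁ m, h₂ m]
    · exact integral_nonneg_of_ae (hlt.mono fun s hs => sub_nonneg.2 hs.le)
  rw [integral_eq_zero_iff_of_nonneg_ae (hlt.mono fun s hs => sub_nonneg.2 hs.le)
    (hgi.sub (hfi m))] at hz
  have hF : ∀ᵐ s ∂P, False := by
    filter_upwards [hz, hlt] with s h3 h4
    simp only [Pi.zero_apply] at h3
    linarith
  simp at hF
  exact IsProbabilityMeasure.ne_zero P hF


/-- Existence of a minimizer of `R_P` for unbounded `ρ`, and uniqueness under strict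
convexity of `ρ`. -/
theorem exists_minimizer_unbounded {k q : ℕ} (ρ : ℝ → ℝ) (s₀ : ℝ) (hρ : RUnb ρ s₀)
    (P : Measure (Obs k q)) [IsProbabilityMeasure P]
    (hmom : Integrable (fun s : Obs k q => fnorm s.2) P)
    (hrank : P {s : Obs k q | (Matrix.of s.2).rank = q} = 1)
    (V : Matrix (Fin k) (Fin k) ℝ) (hV : V.PosDef) :
    (∃ βP : Vec q, ∀ β : Vec q,
      ∫ s, (ρ (mdist s βP V) - ρ (Real.sqrt (s.1 ⬝ᵥ V⁻¹.mulVec s.1))) ∂P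
        ≤ ∫ s, (ρ (mdist s β V) - ρ (Real.sqrt (s.1 ⬝ᵥ V⁻¹.mulVec s.1))) ∂P) ∧
    (StrictConvexOn ℝ Set.univ ρ →
      ∃! βP : Vec q, ∀ β : Vec q,
        ∫ s, (ρ (mdist s βP V) - ρ (Real.sqrt (s.1 ⬝ᵥ V⁻¹.mulVec s.1))) ∂P
          ≤ ∫ s, (ρ (mdist s β V) - ρ (Real.sqrt (s.1 ⬝ᵥ V⁻¹.mulVec s.1))) ∂P) := by
  obtain ⟨T, hT, hTn⟩ := exists_factor V hV
  refine core ρ s₀ hρ P hmom hrank T hT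
    (fun β s => ρ (mdist s β V) - ρ (Real.sqrt (s.1 ⬝ᵥ V⁻¹.mulVec s.1))) ?_
  intro β s
  simp only [mdist, hTn]
end
end
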